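/- arXiv:1405.3193 — 12 statements merged into one kernel-verified Lean document; each statement's English description precedes it below -/
import Mathlib

section
/- R is a cyclic left A-module if and only if R is a cyclic left R-module; that is, there exists x ∈ R with {f(x) : f ∈ A} = R if and only if there exists x ∈ R with R*x = {r*x : r ∈ R} (taking additive spans, equivalently the set itself) equal to R. -/
/-- A (possibly nonunital) ring has local units if every finite set of elements
admits an idempotent acting as a two-sided unit on them. -/
def HasLocalUnits (R : Type*) [NonUnitalRing R] : Prop :=
  ∀ s : Finset R, ∃ u : R, u * u = u ∧ ∀ a ∈ s, u * a = a ∧ a * u = a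

/-- The endomorphism ring `A = End(R_R)` of `R` as a right `R`-module: the subring of
`AddMonoid.End R` consisting of additive endomorphisms `f` with `f (x * r) = f x * r`. -/
def REnd (R : Type*) [NonUnitalRing R] : Subring (AddMonoid.End R) where
  carrier := {f | ∀ x r : R, f (x * r) = f x * r}
  zero_mem' := fun x r => by simp
  one_mem' := fun x r => rfl
  add_mem' := fun {f g} hf hg x r => by
    show f (x * r) + g (x * r) = (f x + g x) * r
    rw [hf, hg, add_mul]
  neg_mem' := fun {f} hf x r => by
    show -(f (x * r)) = -(f x) * r
    rw [hf, neg_mul]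
  mul_mem' := fun {f g} hf hg x r => by
    show f (g (x * r)) = f (g x) * r
    rw [hg, hf]

/-- `lam x = λ_x` is left multiplication by `x`, as an element of `REnd R`. -/
def lam {R : Type*} [NonUnitalRing R] (x : R) : REnd R :=
  ⟨AddMonoidHom.mulLeft x, fun y r => (mul_assoc x y r).symm⟩

/-- `R` is a cyclic left `A`-module iff `R` is a cyclic left `R`-module. -/
theorem cyclic_A_iff_cyclic_R {R : Type*} [NonUnitalRing R] (hR : HasLocalUnits R) :
    (∃ x : R, {y : R | ∃ f : REnd R, (f : AddMonoid.End R) x = y} = Set.univ) ↔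
    (∃ x : R, {y : R | ∃ r : R, r * x = y} = Set.univ) := by
  constructor
  · rintro ⟨x, hx⟩
    refine ⟨x, Set.eq_univ_of_forall fun y => ?_⟩
    obtain ⟨f, hf⟩ : y ∈ {y : R | ∃ f : REnd R, (f : AddMonoid.End R) x = y} := by
      rw [hx]; trivial
    obtain ⟨u, _, hu⟩ := hR {x}
    have hux := (hu x (by simp)).1
    refine ⟨(f : AddMonoid.End R) u, ?_⟩
    have h : (f : AddMonoid.End R) (u * x) = (f : AddMonoid.End R) u * x := f.2 u x
    rw [← h, hux, hf]
  · rintro ⟨x, hx⟩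
    refine ⟨x, Set.eq_univ_of_forall fun y => ?_⟩
    obtain ⟨r, hr⟩ : y ∈ {y : R | ∃ r : R, r * x = y} := by
      rw [hx]; trivial
    exact ⟨lam r, hr⟩
end

section
/- A is a ring of right quotients of λ(R): for all f, g ∈ A with f ≠ 0, there exists an idempotent u ∈ R such that f ∘ λ_u ≠ 0 and both f ∘ λ_u and g ∘ λ_u lie in λ(R). -/
/-- `A` is a ring of right quotients of `λ(R)`. -/
theorem ringOfRightQuotients {R : Type*} [NonUnitalRing R] (hR : HasLocalUnits R)
    (f g : REnd R) (hf : f ≠ 0) :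
    ∃ u : R, u * u = u ∧ f * lam u ≠ 0 ∧
      f * lam u ∈ Set.range (lam : R → REnd R) ∧
      g * lam u ∈ Set.range (lam : R → REnd R) := by
  have key : ∀ (h : REnd R) (u : R), h * lam u = lam (h.1 u) := by
    intro h u
    apply Subtype.ext
    apply AddMonoidHom.ext
    intro y
    exact h.2 u y
  have hx : ∃ x : R, f.1 x ≠ 0 := by
    by_contra hc
    push Not at hc
    exact hf (Subtype.ext (AddMonoidHom.ext hc))
  obtain ⟨x, hx⟩ := hx
  obtain ⟨u, hu, hux⟩ := hR {x}
  have h1 : u * x = x := (hux x (by simp)).1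
  refine ⟨u, hu, ?_, ⟨_, (key f u).symm⟩, ⟨_, (key g u).symm⟩⟩
  intro h0
  apply hx
  have h2 : (f * lam u).1 x = (0 : REnd R).1 x := by rw [h0]
  have h3 : f.1 (u * x) = 0 := h2
  rwa [h1] at h3
end

section
/- Every nonzero two-sided ideal of A meets λ(R) nontrivially: if I is a two-sided ideal of A with I ≠ {0}, then there exists x ∈ R with λ_x ∈ I and λ_x ≠ 0. -/
/-- every nonzero two-sided ideal of `A` meets `λ(R)` nontrivially. -/
theorem twoSidedIdeal_meets_lam {R : Type*} [NonUnitalRing R] (hR : HasLocalUnits R)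
    (I : TwoSidedIdeal (REnd R)) (hI : ∃ f : REnd R, f ∈ I ∧ f ≠ 0) :
    ∃ x : R, lam x ∈ I ∧ lam x ≠ 0 := by
  obtain ⟨f, hf, hne⟩ := hI
  have hy : ∃ y : R, f.1 y ≠ 0 := by
    by_contra h
    push Not at h
    exact hne (Subtype.ext (AddMonoidHom.ext h))
  obtain ⟨y, hy⟩ := hy
  refine ⟨f.1 y, ?_, ?_⟩
  · have h : lam (f.1 y) = f * lam y :=
      Subtype.ext (AddMonoidHom.ext fun r => (f.2 y r).symm)
    rw [h]
    exact I.mul_mem_right _ _ hf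
  · intro h
    obtain ⟨u, _, hu⟩ := hR {f.1 y}
    apply hy
    rw [← (hu (f.1 y) (by simp)).2]
    exact DFunLike.congr_fun (congrArg Subtype.val h) u
end

section
/- Suppose the Jacobson radical of R is zero in the following sense: whenever r ∈ R satisfies that for every s ∈ R there exists q ∈ R with s*r + q − q*(s*r) = 0, then r = 0. Then the Jacobson radical of the unital ring A is zero, i.e. the intersection of all maximal left ideals of A is the zero ideal. -/
/-- if the Jacobson radical of `R` is zero (in the left-quasi-regular sense),
then the Jacobson radical of the unital ring `A`, i.e. the intersection of all maximal
left ideals of `A`, is zero. -/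
theorem jacobson_radical_eq_bot {R : Type*} [NonUnitalRing R] (hR : HasLocalUnits R)
    (hJR : ∀ r : R, (∀ s : R, ∃ q : R, s * r + q - q * (s * r) = 0) → r = 0) :
    sInf {I : Ideal (REnd R) | I.IsMaximal} = ⊥ := by
  rw [← Ring.jacobson_eq_sInf_isMaximal, eq_bot_iff]
  intro f hf
  rw [Ideal.mem_bot]
  apply Subtype.ext
  apply AddMonoidHom.ext
  intro x
  show f.1 x = 0
  apply hJR
  intro s
  have h1 : f * lam x ∈ Ring.jacobson (REnd R) := Ideal.mul_mem_right _ _ hf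
  rw [← Ideal.jacobson_bot, Ideal.mem_jacobson_iff] at h1
  obtain ⟨z, hz⟩ := h1 (-lam s)
  rw [Ideal.mem_bot] at hz
  set y := s * f.1 x with hy
  refine ⟨-(z.1 y), ?_⟩
  have h2 : z.1 (-(s * f.1 (x * y))) + z.1 y - y = 0 :=
    congrArg (fun g : REnd R => g.1 y) hz
  rw [f.2 x y, ← mul_assoc, ← hy, map_neg, z.2 y y] at h2
  rw [neg_mul, ← neg_eq_zero, ← h2]
  abel
end

section
/- Suppose the left singular ideal of R is zero: for every nonzero y ∈ R, the left annihilator lan_R(y) = {r ∈ R : r*y = 0} is not an essential left ideal of R. Then the left singular ideal of A is zero: for every nonzero f ∈ A, the left annihilator {g ∈ A : g ∘ f = 0} is not an essential left ideal of A. -/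
/-- A left ideal of a (possibly nonunital) ring: an additive subgroup closed under
left multiplication. -/
def IsLeftIdeal {R : Type*} [NonUnitalRing R] (I : AddSubgroup R) : Prop :=
  ∀ (r : R), ∀ y ∈ I, r * y ∈ I

/-- The left annihilator `lan_R(y) = {r : r * y = 0}` as an additive subgroup of `R`. -/
def lanSubgroup {R : Type*} [NonUnitalRing R] (y : R) : AddSubgroup R where
  carrier := {r : R | r * y = 0}
  zero_mem' := zero_mul y
  add_mem' := fun {a b} ha hb => by
    show (a + b) * y = 0
    rw [add_mul, ha, hb, add_zero]
  neg_mem' := fun {a} ha => by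
    show (-a) * y = 0
    rw [neg_mul, ha, neg_zero]

/-- The left annihilator `{g : g ∘ f = 0}` as a left ideal of `A = REnd R`. -/
def lanEnd {R : Type*} [NonUnitalRing R] (f : REnd R) : Ideal (REnd R) where
  carrier := {g : REnd R | g * f = 0}
  zero_mem' := zero_mul f
  add_mem' := fun {a b} ha hb => by
    show (a + b) * f = 0
    rw [add_mul, ha, hb, add_zero]
  smul_mem' := fun c g hg => by
    show (c * g) * f = 0
    rw [mul_assoc, hg, mul_zero]

/-- if the left singular ideal of `R` is zero then the left singular ideal
of `A` is zero: the left annihilator of a nonzero element is never essential. -/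
theorem end_nonsingular {R : Type*} [NonUnitalRing R] (hR : HasLocalUnits R)
    (hsing : ∀ y : R, y ≠ 0 →
      ¬ (∀ J : AddSubgroup R, IsLeftIdeal J → J ≠ ⊥ → lanSubgroup y ⊓ J ≠ ⊥)) :
    ∀ f : REnd R, f ≠ 0 →
      ¬ (∀ J : Ideal (REnd R), J ≠ ⊥ → lanEnd f ⊓ J ≠ ⊥) := by
  intro f hf hess
  have hx : ∃ x, f.1 x ≠ 0 := by
    by_contra h
    push Not at h
    exact hf (Subtype.ext (AddMonoidHom.ext h))
  obtain ⟨x, hx⟩ := hx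
  apply hsing _ hx
  intro J hJ hJ0 hbot
  obtain ⟨r, hrJ, hr0⟩ := AddSubgroup.ne_bot_iff_exists_ne_zero.1 hJ0 |>.elim
    fun a ha => (⟨a.1, a.2, fun h => ha (Subtype.ext h)⟩ : ∃ r, r ∈ J ∧ r ≠ 0)
  obtain ⟨u, -, hu⟩ := hR {r}
  obtain ⟨hur, hru⟩ := hu r (Finset.mem_singleton_self r)
  apply hess (Ideal.span {lam r})
  · intro h
    have h1 : lam r = 0 := Ideal.span_singleton_eq_bot.1 h
    have h2 : (lam r).1 u = 0 := by rw [h1]; rfl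
    have h3 : r * u = 0 := h2
    exact hr0 (hru ▸ h3)
  · rw [eq_bot_iff]
    rintro k ⟨hk1, hk2⟩
    obtain ⟨g, rfl⟩ := Ideal.mem_span_singleton'.1 hk2
    have hk1' : g * lam r * f = 0 := hk1
    have e1 : g.1 (r * f.1 x) = 0 := by
      have : (g * lam r * f).1 x = 0 := by rw [hk1']; rfl
      exact this
    rw [g.2 r (f.1 x)] at e1
    have e2 : g.1 r ∈ J := by
      have := g.2 u r
      rw [hur] at this
      rw [this]
      exact hJ _ _ hrJ
    have e3 : g.1 r ∈ lanSubgroup (f.1 x) ⊓ J := ⟨e1, e2⟩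
    rw [hbot] at e3
    have e4 : g.1 r = 0 := e3
    have : g * lam r = 0 := by
      apply Subtype.ext
      apply AddMonoidHom.ext
      intro y
      show g.1 (r * y) = 0
      rw [g.2 r y, e4, zero_mul]
    exact this
end

section
/- Suppose (v_i)_{i∈ι} is a family of pairwise orthogonal idempotents of R (v_i*v_i = v_i and v_i*v_j = 0 for i ≠ j) such that R is the internal direct sum of the left ideals R*v_i (the additive subgroups R*v_i are independent and their sum is R). Then R, regarded as a left A-module via f • x = f(x), is a projective A-module. -/
/-- `R` as a left module over `A = REnd R` via evaluation `f • x = f x`. -/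
instance REnd.instModule {R : Type*} [NonUnitalRing R] : Module (REnd R) R where
  smul f x := (f : AddMonoid.End R) x
  one_smul x := rfl
  mul_smul f g x := rfl
  smul_zero f := map_zero (f : AddMonoid.End R)
  smul_add f x y := map_add (f : AddMonoid.End R) x y
  add_smul f g x := rfl
  zero_smul x := rfl

/-- The left ideal `R * v = {r * v : r ∈ R}` as an additive subgroup of `R`. -/
def leftMulSubgroup {R : Type*} [NonUnitalRing R] (v : R) : AddSubgroup R where
  carrier := Set.range (fun r : R => r * v)
  zero_mem' := ⟨0, zero_mul v⟩
  add_mem' := by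
    rintro a b ⟨r, rfl⟩ ⟨s, rfl⟩
    exact ⟨r + s, add_mul r s v⟩
  neg_mem' := by
    rintro a ⟨r, rfl⟩
    exact ⟨-r, neg_mul r v⟩

/-- if `(v i)` is a family of pairwise orthogonal idempotents such that `R` is
the internal direct sum of the left ideals `R * v i` (independent additive subgroups whose
sum is all of `R`), then `R` is a projective left `A`-module. -/
theorem projective_of_orthogonal_idempotents {R : Type*} [NonUnitalRing R]
    (hR : HasLocalUnits R) {ι : Type*} (v : ι → R)
    (hidem : ∀ i, v i * v i = v i)
    (horth : ∀ i j, i ≠ j → v i * v j = 0)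
    (hindep : ∀ i, leftMulSubgroup (v i) ⊓ (⨆ j ∈ ({i}ᶜ : Set ι), leftMulSubgroup (v j)) = ⊥)
    (hsum : (⨆ i, leftMulSubgroup (v i)) = ⊤) :
    Module.Projective (REnd R) R := by
  have hfin : ∀ x : R, {i | x * v i ≠ 0}.Finite ∧ ∑ᶠ i, x * v i = x := by
    intro x
    have hx : x ∈ ⨆ i, leftMulSubgroup (v i) := by rw [hsum]; trivial
    induction hx using AddSubgroup.iSup_induction' with
    | hp i x hx =>
      obtain ⟨r, rfl⟩ := hx
      have h0 : ∀ j, j ≠ i → r * v i * v j = 0 := fun j hj => by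
        rw [mul_assoc, horth i j hj.symm, mul_zero]
      refine ⟨(Set.finite_singleton i).subset fun j hj => ?_, ?_⟩
      · by_contra h
        exact hj (h0 j h)
      · show ∑ᶠ j, r * v i * v j = r * v i
        rw [finsum_eq_single _ i h0, mul_assoc, hidem]
    | h1 => simp
    | hadd x y _ _ ihx ihy =>
      refine ⟨(ihx.1.union ihy.1).subset fun j hj => ?_, ?_⟩
      · by_contra h
        simp only [Set.mem_union, Set.mem_setOf_eq, not_or, not_not] at h
        exact hj (by rw [add_mul, h.1, h.2, add_zero])
      · simp only [add_mul]
        rw [finsum_add_distrib ihx.1 ihy.1, ihx.2, ihy.2]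
  have hlam0 : lam (0 : R) = 0 := by
    apply Subtype.ext; ext y; exact zero_mul y
  have hfs : ∀ x : R, (Function.support fun i => lam (x * v i)).Finite := fun x =>
    (hfin x).1.subset fun i hi h => hi (by simp only [h, hlam0])
  let s : R →ₗ[REnd R] (ι →₀ REnd R) :=
    { toFun := fun x => Finsupp.ofSupportFinite (fun i => lam (x * v i)) (hfs x)
      map_add' := fun x y => by
        ext i z
        show (x + y) * v i * z = x * v i * z + y * v i * z
        rw [add_mul, add_mul]
      map_smul' := fun f x => by
        ext i z
        show (f : AddMonoid.End R) x * v i * z = (f : AddMonoid.End R) (x * v i * z)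
        rw [f.2, f.2] }
  refine Module.Projective.of_split s (Finsupp.linearCombination (REnd R) v) ?_
  ext x
  show Finsupp.linearCombination (REnd R) v (s x) = x
  rw [Finsupp.linearCombination_apply, Finsupp.sum]
  have h1 : ∀ i, (s x) i • v i = x * v i := fun i => by
    show x * v i * v i = x * v i
    rw [mul_assoc, hidem]
  simp only [h1]
  rw [← finsum_eq_sum_of_support_subset, (hfin x).2]
  intro i hi
  rw [Finset.mem_coe, Finsupp.mem_support_iff]
  intro h
  apply hi
  show x * v i = 0
  rw [← h1, h, zero_smul]
end

section
/- λ(R) is a pure left A-submodule of A: for all m, n ≥ 1, for every family f_{ij} ∈ A (1 ≤ i ≤ m, 1 ≤ j ≤ n) and elements a_1, …, a_m ∈ R, if there exist g_1, …, g_n ∈ A with Σ_{j=1}^n f_{ij} ∘ g_j = λ_{a_i} for all i, then there exist x_1, …, x_n ∈ R with Σ_{j=1}^n f_{ij} ∘ λ_{x_j} = λ_{a_i} for all i. -/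
/-- `λ(R)` is a pure left `A`-submodule of `A`: every finite system of
left `A`-linear equations with constants in `λ(R)` which is solvable in `A` is already
solvable in `λ(R)`. -/
theorem lam_pure_submodule {R : Type*} [NonUnitalRing R] (hR : HasLocalUnits R)
    (m n : ℕ) (hm : 1 ≤ m) (hn : 1 ≤ n)
    (f : Fin m → Fin n → REnd R) (a : Fin m → R)
    (hsol : ∃ g : Fin n → REnd R, ∀ i, (∑ j, f i j * g j) = lam (a i)) :
    ∃ x : Fin n → R, ∀ i, (∑ j, f i j * lam (x j)) = lam (a i) := by
  obtain ⟨g, hg⟩ := hsol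
  classical
  obtain ⟨u, -, hu⟩ := hR (Finset.univ.image a)
  have key : ∀ h : REnd R, lam (h.1 u) = h * lam u := fun h =>
    Subtype.ext (AddMonoidHom.ext fun y => (h.2 u y).symm)
  refine ⟨fun j => (g j).1 u, fun i => ?_⟩
  have hau : a i * u = a i := (hu (a i) (by simp)).2
  have h1 : lam (a i) * lam u = lam (a i) :=
    Subtype.ext (AddMonoidHom.ext fun y => by
      show a i * (u * y) = a i * y
      rw [← mul_assoc, hau])
  simp only [key]
  rw [← h1, ← hg i, Finset.sum_mul]
  simp only [mul_assoc]
end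

section
/- The quotient A ⧸ λ(R), where λ(R) is regarded as a left ideal (left A-submodule) of A, is a flat left A-module. -/
/-- `λ(R)` as a left ideal (left submodule) of `A = REnd R`. -/
def lamIdeal (R : Type*) [NonUnitalRing R] : Ideal (REnd R) where
  carrier := Set.range (lam : R → REnd R)
  zero_mem' := ⟨0, Subtype.ext (AddMonoidHom.ext fun y => zero_mul y)⟩
  add_mem' := fun {a b} ha hb => by
    obtain ⟨x, rfl⟩ := ha; obtain ⟨y, rfl⟩ := hb
    exact ⟨x + y, Subtype.ext (AddMonoidHom.ext fun z => (add_mul x y z).symm).symm⟩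
  smul_mem' := fun f a ha => by
    obtain ⟨x, rfl⟩ := ha
    refine ⟨(f : AddMonoid.End R) x, Subtype.ext (AddMonoidHom.ext fun z => ?_)⟩
    exact (f.2 x z).symm

/-- Flatness of a left module over a (possibly noncommutative) ring, via the standard
equational criterion: every finite relation `∑ aᵢ • xᵢ = 0` factors trivially. -/
def IsFlatModule (A : Type*) (M : Type*) [Ring A] [AddCommGroup M] [Module A M] : Prop :=
  ∀ (n : ℕ) (a : Fin n → A) (x : Fin n → M), (∑ i, a i • x i) = 0 →
    ∃ (m : ℕ) (b : Fin n → Fin m → A) (y : Fin m → M),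
      (∀ i, x i = ∑ j, b i j • y j) ∧ (∀ j, (∑ i, a i * b i j) = 0)

/-- the quotient `A ⧸ λ(R)` is a flat left `A`-module. -/
theorem quotient_lam_flat {R : Type*} [NonUnitalRing R] (hR : HasLocalUnits R) :
    IsFlatModule (REnd R) (REnd R ⧸ lamIdeal R) := by
  intro n a x h
  choose f hf using fun i => Submodule.Quotient.mk_surjective (lamIdeal R) (x i)
  have h1 : (∑ i, a i * f i) ∈ lamIdeal R := by
    rw [← Submodule.Quotient.mk_eq_zero, ← h, ← Submodule.mkQ_apply, map_sum]
    refine Finset.sum_congr rfl fun i _ => ?_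
    rw [← hf i, ← smul_eq_mul, map_smul, Submodule.mkQ_apply]
  obtain ⟨r, hr⟩ := h1
  obtain ⟨u, -, hu⟩ := hR {r}
  have hru : r * u = r := (hu r (Finset.mem_singleton_self r)).2
  have hlam : lam r * lam u = lam r := by
    refine Subtype.ext (AddMonoidHom.ext fun z => ?_)
    show r * (u * z) = r * z
    rw [← mul_assoc, hru]
  refine ⟨1, fun i _ => f i * (1 - lam u), fun _ => Submodule.Quotient.mk 1, fun i => ?_, fun _ => ?_⟩
  · rw [Fin.sum_univ_one, ← hf i, ← Submodule.Quotient.mk_smul, Submodule.Quotient.eq]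
    have : f i - (f i * (1 - lam u)) • (1 : REnd R) = f i • lam u := by
      simp only [smul_eq_mul, mul_one, mul_sub]
      abel
    rw [this]
    exact (lamIdeal R).smul_mem _ ⟨u, rfl⟩
  · simp only [← mul_assoc]
    rw [← Finset.sum_mul, ← hr, mul_sub, mul_one, hlam, sub_self]
end

section
/- If A is von Neumann regular (for every f ∈ A there exists g ∈ A with f = f ∘ g ∘ f), then R is von Neumann regular: for every a ∈ R there exists b ∈ R with a = a*b*a. -/
/-- if `A` is von Neumann regular then `R` is von Neumann regular. -/
theorem vonNeumannRegular_of_end {R : Type*} [NonUnitalRing R] (hR : HasLocalUnits R)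
    (hA : ∀ f : REnd R, ∃ g : REnd R, f = f * g * f) :
    ∀ a : R, ∃ b : R, a = a * b * a := by
  intro a
  obtain ⟨u, -, hu⟩ := hR {a}
  obtain ⟨h1, h2⟩ := hu a (Finset.mem_singleton_self a)
  obtain ⟨g, hg⟩ := hA (lam a)
  refine ⟨g.1 u, ?_⟩
  have h3 : a * u = a * g.1 (a * u) := congrArg (fun f : REnd R => f.1 u) hg
  have h4 : g.1 (u * a) = g.1 u * a := g.2 u a
  rw [h1] at h4
  rw [h2, h4, ← mul_assoc] at h3
  exact h3
end

section
/- If A is π-regular (for every f ∈ A there exist an integer n ≥ 1 and g ∈ A with f^n = f^n ∘ g ∘ f^n), then R is π-regular: for every a ∈ R there exist an integer n ≥ 1 and b ∈ R with a^n = a^n * b * a^n. -/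
/-- `npow₁ a n = a^(n+1)`, the `(n+1)`-fold product, well-defined in a nonunital ring. -/
def npow₁ {R : Type*} [NonUnitalRing R] (a : R) : ℕ → R
  | 0 => a
  | n + 1 => npow₁ a n * a

theorem lam_pow_apply {R : Type*} [NonUnitalRing R] (a : R) (n : ℕ) (x : R) :
    ((lam a ^ (n + 1) : REnd R) : AddMonoid.End R) x = npow₁ a n * x := by
  induction n generalizing x with
  | zero => rw [zero_add, pow_one]; rfl
  | succ n ih =>
    rw [pow_succ]
    show ((lam a ^ (n + 1) : REnd R) : AddMonoid.End R) (a * x) = npow₁ a n * a * x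
    rw [ih, mul_assoc]

/-- if `A` is π-regular then `R` is π-regular
(here `npow₁ a (n-1) = a^n` for `n ≥ 1`). -/
theorem piRegular_of_end {R : Type*} [NonUnitalRing R] (hR : HasLocalUnits R)
    (hA : ∀ f : REnd R, ∃ n : ℕ, 1 ≤ n ∧ ∃ g : REnd R, f ^ n = f ^ n * g * f ^ n) :
    ∀ a : R, ∃ n : ℕ, 1 ≤ n ∧ ∃ b : R, npow₁ a (n - 1) = npow₁ a (n - 1) * b * npow₁ a (n - 1) := by
  intro a
  obtain ⟨n, hn, g, hg⟩ := hA (lam a)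
  obtain ⟨m, rfl⟩ : ∃ m, n = m + 1 := ⟨n - 1, by omega⟩
  refine ⟨m + 1, hn, ?_⟩
  rw [Nat.add_sub_cancel]
  obtain ⟨u, -, hu⟩ := hR {npow₁ a m}
  obtain ⟨h1, h2⟩ := hu _ (Finset.mem_singleton_self _)
  refine ⟨(g : AddMonoid.End R) u, ?_⟩
  have h := congrArg (fun f : REnd R => (f : AddMonoid.End R) u) hg
  change ((lam a ^ (m + 1) : REnd R) : AddMonoid.End R) u =
    ((lam a ^ (m + 1) : REnd R) : AddMonoid.End R) ((g : AddMonoid.End R)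
      (((lam a ^ (m + 1) : REnd R) : AddMonoid.End R) u)) at h
  rw [lam_pow_apply, lam_pow_apply, h2] at h
  have h3 := g.2 u (npow₁ a m)
  rw [h1] at h3
  rw [mul_assoc, ← h3]
  exact h
end

section
/- If A is left weakly regular (every left ideal I of A is idempotent, i.e. I equals the additive span of {f ∘ g : f, g ∈ I}), then R is left weakly regular: every left ideal I of R equals the additive span of {x*y : x, y ∈ I}. -/
/-- if `A` is left weakly regular (every left ideal of `A` is idempotent)
then `R` is left weakly regular (every left ideal of `R` is idempotent). -/
theorem leftWeaklyRegular_of_end {R : Type*} [NonUnitalRing R] (hR : HasLocalUnits R)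
    (hA : ∀ I : Ideal (REnd R),
      AddSubgroup.closure {h : REnd R | ∃ f ∈ I, ∃ g ∈ I, h = f * g} = I.toAddSubgroup) :
    ∀ I : AddSubgroup R, (∀ (r : R), ∀ y ∈ I, r * y ∈ I) →
      AddSubgroup.closure {z : R | ∃ x ∈ I, ∃ y ∈ I, z = x * y} = I := by
  intro I hI
  have hmul : ∀ (f : REnd R) (x : R), f * lam x = lam (f.1 x) := by
    intro f x
    apply Subtype.ext
    ext y
    exact f.2 x y
  have hmem : ∀ (f : REnd R), ∀ x ∈ I, f.1 x ∈ I := by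
    intro f x hx
    obtain ⟨u, -, hu⟩ := hR {x}
    have h1 := (hu x (by simp)).1
    have h2 := f.2 u x
    rw [h1] at h2
    rw [h2]
    exact hI _ _ hx
  have hadd : ∀ x y : R, lam x + lam y = lam (x + y) := by
    intro x y
    apply Subtype.ext
    ext z
    exact (add_mul x y z).symm
  have hneg : ∀ x : R, -lam x = lam (-x) := by
    intro x
    apply Subtype.ext
    ext z
    exact (neg_mul x z).symm
  have hzero : (0 : REnd R) = lam 0 := by
    apply Subtype.ext
    ext z
    exact (zero_mul z).symm
  let J : Ideal (REnd R) :=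
    { carrier := {f | ∃ x ∈ I, f = lam x}
      zero_mem' := ⟨0, I.zero_mem, hzero⟩
      add_mem' := by
        rintro _ _ ⟨x, hx, rfl⟩ ⟨y, hy, rfl⟩
        exact ⟨x + y, I.add_mem hx hy, hadd x y⟩
      smul_mem' := by
        rintro f _ ⟨x, hx, rfl⟩
        exact ⟨f.1 x, hmem f x hx, hmul f x⟩ }
  apply le_antisymm
  · rw [AddSubgroup.closure_le]
    rintro _ ⟨x, _, y, hy, rfl⟩
    exact hI x y hy
  · intro a ha
    have hJ : lam a ∈ J.toAddSubgroup := ⟨a, ha, rfl⟩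
    rw [← hA J] at hJ
    have key : ∃ x ∈ AddSubgroup.closure {z : R | ∃ x ∈ I, ∃ y ∈ I, z = x * y},
        lam a = lam x := by
      generalize lam a = k at hJ
      induction hJ using AddSubgroup.closure_induction with
      | mem h hh =>
        obtain ⟨_, ⟨x, hx, rfl⟩, _, ⟨y, hy, rfl⟩, rfl⟩ := hh
        exact ⟨x * y, AddSubgroup.subset_closure ⟨x, hx, y, hy, rfl⟩, hmul (lam x) y⟩
      | zero => exact ⟨0, zero_mem _, hzero⟩
      | add f g _ _ hf hg =>
        obtain ⟨x, hx, rfl⟩ := hf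
        obtain ⟨y, hy, rfl⟩ := hg
        exact ⟨x + y, add_mem hx hy, hadd x y⟩
      | neg f _ hf =>
        obtain ⟨x, hx, rfl⟩ := hf
        exact ⟨-x, neg_mem hx, hneg x⟩
    obtain ⟨x, hx, h⟩ := key
    classical
    obtain ⟨u, -, hu⟩ := hR {a, x}
    have h3 : a * u = x * u := congrArg (fun f : REnd R => f.1 u) h
    rw [(hu a (by simp)).2, (hu x (by simp)).2] at h3
    rw [h3]
    exact hx
end

section
/- Let M be a direct sum ⊕_{i∈I} S_i over an infinite index set I, where the S_i are pairwise isomorphic simple submodules of M. Then E := End_T(M) is not self-injective as a left module over itself: E is not an injective left E-module. -/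
theorem end_aux {R : Type*} [Ring R] (hR : Module.Injective R R) (e u : ℕ → R)
    (h0 : ∀ i j, i ≠ j → e i * e j = 0) (h1 : ∀ i, e i * e i = e i)
    (hu : ∀ i, e i * u i = u i) : ∃ g : R, ∀ i, e i * g = u i := by
  classical
  let h : (ℕ →₀ R) →ₗ[R] R := Finsupp.linearCombination R e
  let k : (ℕ →₀ R) →ₗ[R] R := Finsupp.linearCombination R u
  have hk : LinearMap.ker h ≤ LinearMap.ker k := by
    intro f hf
    have hf' : f.sum (fun i a => a * e i) = 0 := hf
    have key : ∀ m, f m * e m = 0 := by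
      intro m
      have h2 := congrArg (fun z => z * e m) hf'
      simp only [Finsupp.sum, Finset.sum_mul, zero_mul, mul_assoc] at h2
      rw [Finset.sum_eq_single m] at h2
      · rwa [h1] at h2
      · intro b _ hb
        rw [h0 b m hb, mul_zero]
      · intro hm
        rw [Finsupp.notMem_support_iff.mp hm, zero_mul]
    change f.sum (fun i a => a * u i) = 0
    refine Finset.sum_eq_zero fun i _ => ?_
    change f i * u i = 0
    rw [← hu i, ← mul_assoc, key, zero_mul]
  have hinj : Function.Injective ((LinearMap.ker h).liftQ h le_rfl) :=
    LinearMap.ker_eq_bot.mp (Submodule.ker_liftQ_eq_bot _ _ _ le_rfl)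
  obtain ⟨ψ, hψ⟩ := hR.out _ hinj ((LinearMap.ker h).liftQ k hk)
  refine ⟨ψ 1, fun i => ?_⟩
  have := hψ ((LinearMap.ker h).mkQ (Finsupp.single i 1))
  simp only [Submodule.mkQ_apply, Submodule.liftQ_apply] at this
  simp only [h, k, Finsupp.linearCombination_single, one_smul] at this
  rw [← this, ← smul_eq_mul, ← map_smul, smul_eq_mul, mul_one]

/-- if `M` is the internal direct sum of an infinite family of pairwise
isomorphic simple submodules, then `E = End_T(M)` is not left self-injective. -/
theorem end_not_selfInjective {T M : Type*} [Ring T] [AddCommGroup M] [Module T M]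
    {ι : Type*} [DecidableEq ι] [Infinite ι] (S : ι → Submodule T M)
    (hsimple : ∀ i, IsSimpleModule T (S i))
    (hiso : ∀ i j, Nonempty ((S i) ≃ₗ[T] (S j)))
    (hinternal : DirectSum.IsInternal S) :
    ¬ Module.Injective (Module.End T M) (Module.End T M) := by
  intro hE
  let c : (DirectSum ι fun i => S i) ≃ₗ[T] M :=
    LinearEquiv.ofBijective (DirectSum.coeLinearMap S) hinternal
  let p : ∀ i, M →ₗ[T] S i := fun i => DirectSum.component T ι (fun i => S i) i ∘ₗ c.symm.toLinearMap
  have hc : ∀ i (x : S i), c.symm x = DirectSum.lof T ι (fun i => S i) i x := by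
    intro i x
    rw [LinearEquiv.symm_apply_eq]
    exact (DirectSum.coeLinearMap_lof S i x).symm
  have hp1 : ∀ i (x : S i), p i x = x := by
    intro i x
    simp only [p, LinearMap.comp_apply, LinearEquiv.coe_coe, hc]
    exact DirectSum.component.lof_self T (M := fun i => S i) i x
  have hp0 : ∀ i j (x : S j), i ≠ j → p i x = 0 := by
    intro i j x hij
    simp only [p, LinearMap.comp_apply, LinearEquiv.coe_coe, hc]
    rw [DirectSum.component.of, dif_neg hij.symm]
  let a : ℕ ↪ ι := Infinite.natEmbedding ι
  let φ : ∀ n, S (a 0) ≃ₗ[T] S (a n) := fun n => (hiso _ _).some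
  obtain ⟨g, hg⟩ := end_aux hE (fun n => (S (a n)).subtype ∘ₗ p (a n))
    (fun n => (S (a n)).subtype ∘ₗ (φ n).toLinearMap ∘ₗ p (a 0))
    (by
      intro i j hij
      ext x
      simp [hp0 _ _ _ (a.injective.ne hij)])
    (by
      intro i
      ext x
      simp [hp1])
    (by
      intro i
      ext x
      simp [hp1])
  have := hsimple (a 0)
  have := IsSimpleModule.nontrivial T (S (a 0))
  obtain ⟨x, hx⟩ := exists_ne (0 : S (a 0))
  have hne : ∀ n, c.symm (g x) (a n) ≠ 0 := by
    intro n hn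
    have h := LinearMap.congr_fun (hg n) (x : M)
    have h3 : p (a n) (g x) = φ n (p (a 0) x) := Subtype.ext h
    rw [hp1] at h3
    have h4 : p (a n) (g x) = 0 := hn
    rw [h4] at h3
    exact hx ((φ n).map_eq_zero_iff.mp h3.symm)
  have hfin : {i | c.symm (g x) i ≠ 0}.Finite := DFinsupp.finite_support _
  exact Set.infinite_range_of_injective a.injective
    (hfin.subset (by rintro _ ⟨n, rfl⟩; exact hne n))
end
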